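/- Let u and v be lists over a type with decidable equality. Suppose x is an element with 2·count(x, u) ≥ F(u) (a 2-approximate mode of u) and y is an element with 2·count(y, v) ≥ F(v) (a 2-approximate mode of v). Let z := x if count(x, u) ≥ count(y, v) and z := y otherwise. Then 4·count(z, u ++ v) ≥ F(u ++ v); that is, z is a 4-approximate mode of the concatenation u ++ v. -/

import Mathlib

/-- The frequency of a mode of a list: the maximum number of occurrences of any element. -/
def modeFreq {α : Type*} [DecidableEq α] (c : List α) : ℕ :=
  (c.map (fun x => c.count x)).foldr max 0

theorem modeFreq_le_iff {α : Type*} [DecidableEq α] {c : List α} {n : ℕ} :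
    modeFreq c ≤ n ↔ ∀ w, c.count w ≤ n := by
  have foldr_le (l : List ℕ) : l.foldr max 0 ≤ n ↔ ∀ a ∈ l, a ≤ n := by
    induction l with
    | nil => simp
    | cons a l ih => simp [ih]
  rw [modeFreq, foldr_le]
  simp only [List.mem_map, forall_exists_index, and_imp, forall_apply_eq_imp_iff₂]
  refine ⟨fun h w => ?_, fun h w _ => h w⟩
  by_cases hw : w ∈ c
  · exact h w hw
  · simp [List.count_eq_zero_of_not_mem hw]

/-- If `x` is a 2-approximate mode of `u` and `y` is a 2-approximate mode of `v`, then
the more frequent of the two is a 4-approximate mode of the concatenation `u ++ v`. -/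
theorem stmt5 {α : Type*} [DecidableEq α] (u v : List α) (x y : α)
    (hx : 2 * u.count x ≥ modeFreq u) (hy : 2 * v.count y ≥ modeFreq v) :
    4 * ((u ++ v).count (if u.count x ≥ v.count y then x else y)) ≥ modeFreq (u ++ v) := by
  refine modeFreq_le_iff.2 fun w => ?_
  have hu := modeFreq_le_iff.1 hx w
  have hv := modeFreq_le_iff.1 hy w
  simp only [List.count_append]
  split_ifs <;> omega
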